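/- The pointwise nondecreasing sequence Tⁿ0 converges pointwise on ℝ as n → ∞, and its limit equals the unique fixed point J of T in S. -/

import Mathlib

open MeasureTheory Set Filter Topology

noncomputable section

/-- The constant `b̄ = β ∫ z⁺ ν(dz) / (1-β)`. -/
def bbar (ν : Measure ℝ) (β : ℝ) : ℝ := β * (∫ z, max z 0 ∂ν) / (1 - β)

/-- The dynamic programming operator `T`. -/
def Tdiv (ν : Measure ℝ) (β γ : ℝ) (v : ℝ → ℝ) (x : ℝ) : ℝ :=
  if 0 ≤ x then
    sSup ((fun a => a - (β / γ) * Real.log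
      ((∫ z in Ici (a - x), Real.exp (-(γ * v (x - a + z))) ∂ν)
        + (ν (Iio (a - x))).toReal)) '' Icc 0 x)
  else 0

/-- Membership in the set `S₀`. -/
def memS0 (ν : Measure ℝ) (β : ℝ) (v : ℝ → ℝ) : Prop :=
  (∀ x, 0 ≤ v x) ∧ (∀ x, 0 ≤ x → v x ≤ x + bbar ν β) ∧ (∀ x, x < 0 → v x = 0)
    ∧ MonotoneOn v (Ici 0) ∧ ContinuousOn v (Ici 0)

/-- Membership in the set `S`. -/
def memS (ν : Measure ℝ) (β : ℝ) (v : ℝ → ℝ) : Prop :=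
  (∀ x, 0 ≤ v x) ∧ (∀ x, 0 ≤ x → x ≤ v x ∧ v x ≤ x + bbar ν β) ∧ (∀ x, x < 0 → v x = 0)
    ∧ MonotoneOn v (Ici 0) ∧ ContinuousOn v (Ici 0)

/-- A decision rule. -/
def DecisionRule (α : ℝ → ℝ) : Prop :=
  Measurable α ∧ (∀ x, 0 ≤ x → α x ∈ Icc 0 x) ∧ (∀ x, x < 0 → α x = 0)

/-- The operator `L_α` associated with a decision rule `α`. -/
def Ldiv (ν : Measure ℝ) (β γ : ℝ) (α : ℝ → ℝ) (v : ℝ → ℝ) (x : ℝ) : ℝ :=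
  if 0 ≤ x then
    α x - (β / γ) * Real.log
      ((∫ z in Ici (α x - x), Real.exp (-(γ * v (x - α x + z))) ∂ν)
        + (ν (Iio (α x - x))).toReal)
  else 0

/-- The function `Γ` associated with a value function `J`. -/
def Gam (ν : Measure ℝ) (β γ : ℝ) (J : ℝ → ℝ) (x : ℝ) : ℝ :=
  -(β / γ) * Real.log
    ((∫ z in Ici (-x), Real.exp (-(γ * J (x + z))) ∂ν) + (ν (Iio (-x))).toReal)

end

/-- The functions on which the operator `Tdiv` is monotone and contracting: nondecreasing
functions vanishing on the negative half-line. -/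
structure Admissible (v : ℝ → ℝ) : Prop where
  mono : Monotone v
  eq_zero_of_neg : ∀ x, x < 0 → v x = 0

namespace Admissible

variable {ν : Measure ℝ} {β γ : ℝ} {v w : ℝ → ℝ}

lemma zero : Admissible (fun _ => 0) := ⟨monotone_const, fun _ _ => rfl⟩

lemma of_memS (hv : memS ν β v) : Admissible v := by
  obtain ⟨hnn, -, hz, hm, -⟩ := hv
  refine ⟨fun x y hxy => ?_, hz⟩
  rcases lt_or_ge x 0 with hx | hx
  · rw [hz x hx]; exact hnn y
  · exact hm hx (hx.trans hxy) hxy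

lemma nonneg (hv : Admissible v) (x : ℝ) : 0 ≤ v x := by
  rw [← hv.eq_zero_of_neg (min x (-1)) (by simp)]
  exact hv.mono (min_le_left _ _)

lemma exp_le_one (hv : Admissible v) (hγ : 0 < γ) (x : ℝ) : Real.exp (-(γ * v x)) ≤ 1 :=
  Real.exp_le_one_iff.2 (by have := mul_nonneg hγ.le (hv.nonneg x); linarith)

variable [IsProbabilityMeasure ν]

lemma integrable_exp (hv : Admissible v) (hγ : 0 < γ) (y : ℝ) :
    Integrable (fun z => Real.exp (-(γ * v (y + z)))) ν := by
  have hmeas : Measurable fun z => Real.exp (-(γ * v (y + z))) :=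
    ((hv.mono.measurable.comp (measurable_const_add y)).const_mul γ).neg.exp
  refine (integrable_const (1 : ℝ)).mono' hmeas.aestronglyMeasurable (ae_of_all _ fun z => ?_)
  rw [Real.norm_of_nonneg (Real.exp_pos _).le]
  exact hv.exp_le_one hγ _

lemma integral_exp_pos (hv : Admissible v) (hγ : 0 < γ) (y : ℝ) :
    0 < ∫ z, Real.exp (-(γ * v (y + z))) ∂ν :=
  MeasureTheory.integral_exp_pos (hv.integrable_exp hγ y)

lemma integral_exp_le_one (hv : Admissible v) (hγ : 0 < γ) (y : ℝ) :
    ∫ z, Real.exp (-(γ * v (y + z))) ∂ν ≤ 1 := by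
  simpa using integral_mono (μ := ν) (hv.integrable_exp hγ y) (integrable_const (1 : ℝ))
    (fun z => hv.exp_le_one hγ _)

lemma setIntegral_add_measure (hv : Admissible v) (hγ : 0 < γ) (x a : ℝ) :
    (∫ z in Ici (a - x), Real.exp (-(γ * v (x - a + z))) ∂ν) + (ν (Iio (a - x))).toReal
      = ∫ z, Real.exp (-(γ * v (x - a + z))) ∂ν := by
  have hruin : ∫ z in Iio (a - x), Real.exp (-(γ * v (x - a + z))) ∂ν
      = (ν (Iio (a - x))).toReal := by
    rw [setIntegral_congr_fun (g := fun _ => (1 : ℝ)) measurableSet_Iio fun z hz => ?_]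
    · simp [Measure.real]
    · have : x - a + z < 0 := by have := mem_Iio.1 hz; linarith
      simp [hv.eq_zero_of_neg _ this]
  rw [← hruin, ← compl_Ici]
  exact integral_add_compl measurableSet_Ici (hv.integrable_exp hγ (x - a))

lemma Tdiv_eq (hv : Admissible v) (hγ : 0 < γ) {x : ℝ} (hx : 0 ≤ x) :
    Tdiv ν β γ v x = sSup ((fun a => a - β / γ *
      Real.log (∫ z, Real.exp (-(γ * v (x - a + z))) ∂ν)) '' Icc 0 x) := by
  simp only [Tdiv, if_pos hx, hv.setIntegral_add_measure hγ]

lemma bddAbove_image (hv : Admissible v) (hβ : 0 < β) (hγ : 0 < γ) (x : ℝ) :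
    BddAbove ((fun a => a - β / γ *
      Real.log (∫ z, Real.exp (-(γ * v (x - a + z))) ∂ν)) '' Icc 0 x) := by
  refine ⟨x - β / γ * Real.log (∫ z, Real.exp (-(γ * v (x + z))) ∂ν), ?_⟩
  rintro _ ⟨a, ha, rfl⟩
  refine sub_le_sub ha.2 (mul_le_mul_of_nonneg_left ?_ (div_pos hβ hγ).le)
  refine Real.log_le_log (hv.integral_exp_pos hγ x)
    (integral_mono (hv.integrable_exp hγ _) (hv.integrable_exp hγ _) fun z => ?_)
  have := hv.mono (show x - a + z ≤ x + z by linarith [ha.1])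
  exact Real.exp_le_exp.2 (neg_le_neg (mul_le_mul_of_nonneg_left this hγ.le))

lemma le_Tdiv (hv : Admissible v) (hβ : 0 < β) (hγ : 0 < γ) {x a : ℝ} (ha : a ∈ Icc 0 x) :
    a - β / γ * Real.log (∫ z, Real.exp (-(γ * v (x - a + z))) ∂ν) ≤ Tdiv ν β γ v x := by
  rw [hv.Tdiv_eq hγ (ha.1.trans ha.2)]
  exact le_csSup (hv.bddAbove_image hβ hγ x) (mem_image_of_mem _ ha)

lemma Tdiv_le (hv : Admissible v) (hγ : 0 < γ) {x M : ℝ} (hx : 0 ≤ x)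
    (h : ∀ a ∈ Icc 0 x,
      a - β / γ * Real.log (∫ z, Real.exp (-(γ * v (x - a + z))) ∂ν) ≤ M) :
    Tdiv ν β γ v x ≤ M := by
  rw [hv.Tdiv_eq hγ hx]
  exact csSup_le ((nonempty_Icc.2 hx).image _) (forall_mem_image.2 h)

lemma self_le_Tdiv (hv : Admissible v) (hβ : 0 < β) (hγ : 0 < γ) {x : ℝ} (hx : 0 ≤ x) :
    x ≤ Tdiv ν β γ v x := by
  refine le_trans ?_ (hv.le_Tdiv hβ hγ (right_mem_Icc.2 hx))
  have := Real.log_nonpos (hv.integral_exp_pos (ν := ν) hγ (x - x)).le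
    (hv.integral_exp_le_one hγ (x - x))
  have := mul_nonpos_of_nonneg_of_nonpos (div_pos hβ hγ).le this
  linarith

lemma Tdiv_admissible (hv : Admissible v) (hβ : 0 < β) (hγ : 0 < γ) :
    Admissible (Tdiv ν β γ v) := by
  have hz : ∀ x, x < 0 → Tdiv ν β γ v x = 0 := fun x hx => if_neg hx.not_ge
  refine ⟨fun x y hxy => ?_, hz⟩
  rcases lt_or_ge x 0 with hx | hx
  · rw [hz x hx]
    rcases lt_or_ge y 0 with hy | hy
    · exact (hz y hy).ge
    · exact hy.trans (hv.self_le_Tdiv hβ hγ hy)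
  · refine hv.Tdiv_le hγ hx fun a ha => ?_
    have h := hv.le_Tdiv (ν := ν) hβ hγ (x := y) (a := a + (y - x))
      ⟨by linarith [ha.1], by linarith [ha.2]⟩
    rw [show y - (a + (y - x)) = x - a by ring] at h
    linarith

lemma iterate_Tdiv (hv : Admissible v) (hβ : 0 < β) (hγ : 0 < γ) (n : ℕ) :
    Admissible ((Tdiv ν β γ)^[n] v) := by
  induction n with
  | zero => exact hv
  | succ n ih =>
    rw [Function.iterate_succ_apply']
    exact ih.Tdiv_admissible hβ hγ

/-- Combined monotonicity and discounting: this is Blackwell's contraction condition. -/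
lemma Tdiv_le_Tdiv_add (hw : Admissible w) (hv : Admissible v) (hβ : 0 < β) (hγ : 0 < γ)
    {c : ℝ} (hc : 0 ≤ c) (h : ∀ x, w x ≤ v x + c) (x : ℝ) :
    Tdiv ν β γ w x ≤ Tdiv ν β γ v x + β * c := by
  rcases lt_or_ge x 0 with hx | hx
  · simpa [Tdiv, hx.not_ge] using mul_nonneg hβ.le hc
  refine hw.Tdiv_le hγ hx fun a ha => ?_
  have hint : Real.exp (-(γ * c)) * ∫ z, Real.exp (-(γ * v (x - a + z))) ∂ν
      ≤ ∫ z, Real.exp (-(γ * w (x - a + z))) ∂ν := by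
    rw [← integral_const_mul]
    refine integral_mono ((hv.integrable_exp hγ _).const_mul _) (hw.integrable_exp hγ _)
      fun z => ?_
    simp only [← Real.exp_add]
    refine Real.exp_le_exp.2 ?_
    have := mul_le_mul_of_nonneg_left (h (x - a + z)) hγ.le
    linarith
  have hpos := hv.integral_exp_pos (ν := ν) hγ (x - a)
  have hlog := Real.log_le_log (mul_pos (Real.exp_pos _) hpos) hint
  rw [Real.log_mul (Real.exp_pos _).ne' hpos.ne', Real.log_exp] at hlog
  have hmul := mul_le_mul_of_nonneg_left hlog (div_pos hβ hγ).le
  have hcancel : β / γ * (-(γ * c) + Real.log (∫ z, Real.exp (-(γ * v (x - a + z))) ∂ν))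
      = -(β * c) + β / γ * Real.log (∫ z, Real.exp (-(γ * v (x - a + z))) ∂ν) := by
    field_simp
  have := hv.le_Tdiv (ν := ν) hβ hγ ha
  linarith

lemma Tdiv_mono (hw : Admissible w) (hv : Admissible v) (hβ : 0 < β) (hγ : 0 < γ)
    (h : ∀ x, w x ≤ v x) (x : ℝ) : Tdiv ν β γ w x ≤ Tdiv ν β γ v x := by
  simpa using hw.Tdiv_le_Tdiv_add (ν := ν) hv hβ hγ le_rfl (by simpa using h) x

lemma iterate_Tdiv_le_succ (hβ : 0 < β) (hγ : 0 < γ) (n : ℕ) (x : ℝ) :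
    (Tdiv ν β γ)^[n] (fun _ => 0) x ≤ (Tdiv ν β γ)^[n + 1] (fun _ => 0) x := by
  induction n generalizing x with
  | zero => exact (zero.Tdiv_admissible hβ hγ).nonneg x
  | succ n ih =>
    rw [Function.iterate_succ_apply', Function.iterate_succ_apply' _ (n + 1)]
    exact (zero.iterate_Tdiv hβ hγ n).Tdiv_mono (zero.iterate_Tdiv hβ hγ (n + 1)) hβ hγ ih x

lemma iterate_Tdiv_le_fixedPoint (hv : Admissible v) (hβ : 0 < β) (hγ : 0 < γ)
    (hfix : Tdiv ν β γ v = v) (n : ℕ) (x : ℝ) : (Tdiv ν β γ)^[n] (fun _ => 0) x ≤ v x := by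
  induction n generalizing x with
  | zero => exact hv.nonneg x
  | succ n ih =>
    rw [Function.iterate_succ_apply', ← hfix]
    exact (zero.iterate_Tdiv hβ hγ n).Tdiv_mono hv hβ hγ ih x

lemma fixedPoint_le_iterate_Tdiv_add (hv : Admissible v) (hβ : 0 < β) (hγ : 0 < γ)
    (hfix : Tdiv ν β γ v = v) {b : ℝ} (hb : 0 ≤ b) (hle : ∀ x, 0 ≤ x → v x ≤ x + b)
    (n : ℕ) (x : ℝ) : v x ≤ (Tdiv ν β γ)^[n + 1] (fun _ => 0) x + β ^ n * b := by
  induction n generalizing x with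
  | zero =>
    have hT := (zero.Tdiv_admissible (ν := ν) hβ hγ).nonneg x
    simp only [zero_add, Function.iterate_one, pow_zero, one_mul]
    rcases lt_or_ge x 0 with hx | hx
    · rw [hv.eq_zero_of_neg x hx]; linarith
    · linarith [hle x hx, zero.self_le_Tdiv (ν := ν) hβ hγ hx]
  | succ n ih =>
    rw [Function.iterate_succ_apply' _ (n + 1), ← congrFun hfix x, pow_succ', mul_assoc]
    exact hv.Tdiv_le_Tdiv_add (zero.iterate_Tdiv hβ hγ (n + 1)) hβ hγ (by positivity) ih x

end Admissible

lemma bbar_nonneg (ν : Measure ℝ) {β : ℝ} (hβ : β ∈ Ioo (0 : ℝ) 1) : 0 ≤ bbar ν β :=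
  div_nonneg (mul_nonneg hβ.1.le (integral_nonneg fun _ => le_max_right _ _))
    (sub_nonneg.2 hβ.2.le)

/-- the pointwise nondecreasing sequence `Tⁿ 0` converges pointwise,
and its limit equals the unique fixed point `J` of `T` in `S`. -/
theorem value_iteration_converges (ν : Measure ℝ) [IsProbabilityMeasure ν]
    (hac : ν ≪ volume) (hint : Integrable (fun z => max z 0) ν)
    (hneg : 0 < ν (Iio 0)) (β γ : ℝ) (hβ : β ∈ Ioo (0:ℝ) 1) (hγ : 0 < γ)
    (J : ℝ → ℝ) (hJ : memS ν β J) (hfix : Tdiv ν β γ J = J) :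
    (∀ n : ℕ, ∀ x : ℝ,
      (Tdiv ν β γ)^[n] (fun _ => 0) x ≤ (Tdiv ν β γ)^[n + 1] (fun _ => 0) x) ∧
    (∀ x : ℝ, Tendsto (fun n => (Tdiv ν β γ)^[n] (fun _ => 0) x) atTop (𝓝 (J x))) := by
  have hadm := Admissible.of_memS hJ
  refine ⟨Admissible.iterate_Tdiv_le_succ hβ.1 hγ, fun x => ?_⟩
  rw [← tendsto_add_atTop_iff_nat 1]
  have hlow : Tendsto (fun n : ℕ => J x - β ^ n * bbar ν β) atTop (𝓝 (J x)) := by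
    simpa using ((tendsto_pow_atTop_nhds_zero_of_lt_one hβ.1.le hβ.2).mul_const
      (bbar ν β)).const_sub (J x)
  refine tendsto_of_tendsto_of_tendsto_of_le_of_le hlow tendsto_const_nhds (fun n => ?_)
    fun n => hadm.iterate_Tdiv_le_fixedPoint hβ.1 hγ hfix (n + 1) x
  exact sub_le_iff_le_add.2 (hadm.fixedPoint_le_iterate_Tdiv_add hβ.1 hγ hfix
    (bbar_nonneg ν hβ) (fun y hy => (hJ.2.1 y hy).2) n x)
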